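/- arXiv:2309.15355 — 2 statements merged into one kernel-verified Lean document; each statement's English description precedes it below -/
import Mathlib

section
/- Let β ∈ ℝ^p have at most s nonzero coordinates with support S, let σ > 0, λ = √(2·log p/n), let s₀ ≥ 1 be the essential sparsity of β, and let T₀ be a set of indices of the s₀ largest coordinates of β in absolute value. Let β_init ∈ ℝ^p be arbitrary and set h = β_init − β_{T₀}. Suppose ‖h_{T₀}‖₂ ≤ D₀′·λσ·√s₀ and ‖h_{T₀^c}‖₁ ≤ D₁·λσ·s₀ for some constants D₀′, D₁ > 0. For C₄ > 0, set t₀ = C₄λσ, I = {j : |β_init,j| ≥ t₀}, and 𝒟 = {1,…,p} \ I. Then |I| ≤ s₀·(1 + D₁/C₄), |I ∪ S| ≤ s + s₀·D₁/C₄, and ‖β_𝒟‖₂ ≤ √((D₀′ + C₄)² + 1)·λσ·√s₀. -/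
open Finset Matrix Real
open scoped BigOperators Classical

noncomputable section

namespace ThreshLasso

/-- ℓ₂ norm of a finite real vector. -/
def l2 {m : ℕ} (v : Fin m → ℝ) : ℝ := Real.sqrt (∑ i, (v i) ^ 2)

/-- ℓ₁ norm of a finite real vector. -/
def l1 {m : ℕ} (v : Fin m → ℝ) : ℝ := ∑ i, |v i|

/-- Restriction of a vector to a set of coordinates (zero outside). -/
def restr {p : ℕ} (v : Fin p → ℝ) (T : Finset (Fin p)) : Fin p → ℝ :=
  fun j => if j ∈ T then v j else 0

/-- Support of a vector, as a `Finset`. -/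
def supp {p : ℕ} (v : Fin p → ℝ) : Finset (Fin p) :=
  Finset.univ.filter fun j => v j ≠ 0

/-- `L` is the minimal `m`-sparse eigenvalue `Λ_min(m)` of `X`:
the least value of `‖Xv‖₂²/(n‖v‖₂²)` over nonzero `v` with at most `m`
nonzero coordinates. -/
def IsLambdaMin {n p : ℕ} (X : Matrix (Fin n) (Fin p) ℝ) (m : ℕ) (L : ℝ) : Prop :=
  IsLeast {r : ℝ | ∃ v : Fin p → ℝ, v ≠ 0 ∧ (supp v).card ≤ m ∧
    r = (l2 (X.mulVec v)) ^ 2 / (n * (l2 v) ^ 2)} L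

/-- `L` is the maximal `m`-sparse eigenvalue `Λ_max(m)` of `X`
(with the convention `Λ_max(0) = 0`, implemented by inserting `0` in the set,
which does not change the maximum when `m ≥ 1`). -/
def IsLambdaMax {n p : ℕ} (X : Matrix (Fin n) (Fin p) ℝ) (m : ℕ) (L : ℝ) : Prop :=
  IsGreatest (insert (0 : ℝ) {r : ℝ | ∃ v : Fin p → ℝ, v ≠ 0 ∧ (supp v).card ≤ m ∧
    r = (l2 (X.mulVec v)) ^ 2 / (n * (l2 v) ^ 2)}) L

/-- `θ` is the restricted orthogonality constant `θ_{m,m'}` of `X`: the smallest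
nonnegative `t` such that `|⟨Xu, Xu'⟩|/n ≤ t‖u‖₂‖u'‖₂` for all `u, u'` supported
on disjoint sets of cardinality at most `m`, `m'` respectively. -/
def IsTheta {n p : ℕ} (X : Matrix (Fin n) (Fin p) ℝ) (m m' : ℕ) (θ : ℝ) : Prop :=
  IsLeast {t : ℝ | 0 ≤ t ∧ ∀ (u u' : Fin p → ℝ) (T T' : Finset (Fin p)),
    Disjoint T T' → T.card ≤ m → T'.card ≤ m' →
    (∀ j, j ∉ T → u j = 0) → (∀ j, j ∉ T' → u' j = 0) →
    |∑ i, (X.mulVec u i) * (X.mulVec u' i)| / n ≤ t * (l2 u * l2 u')} θ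

/-- Restricted eigenvalue condition `RE(s₀, k₀, X)` with constant `K`. -/
def RECond {n p : ℕ} (X : Matrix (Fin n) (Fin p) ℝ) (s₀ : ℕ) (k₀ K : ℝ) : Prop :=
  0 < K ∧ ∀ (v : Fin p → ℝ) (J : Finset (Fin p)), J.card ≤ s₀ →
    l1 (restr v Jᶜ) ≤ k₀ * l1 (restr v J) →
    l2 (restr v J) / K ≤ l2 (X.mulVec v) / Real.sqrt n

/-- `s₀` is the essential sparsity of `β`: the smallest nonnegative integer `m`
with `∑ᵢ min(βᵢ², λ²σ²) ≤ m λ²σ²`. -/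
def EssSparsity {p : ℕ} (β : Fin p → ℝ) (lam σ : ℝ) (s₀ : ℕ) : Prop :=
  IsLeast {m : ℕ | ∑ i, min ((β i) ^ 2) (lam ^ 2 * σ ^ 2) ≤ (m : ℝ) * (lam ^ 2 * σ ^ 2)} s₀

/-- `T₀` is a set of indices of the `s₀` largest coordinates of `β` in absolute value. -/
def TopSet {p : ℕ} (β : Fin p → ℝ) (s₀ : ℕ) (T₀ : Finset (Fin p)) : Prop :=
  T₀.card = s₀ ∧ ∀ i ∈ T₀, ∀ j, j ∉ T₀ → |β j| ≤ |β i|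

/-- `T₁` is a set of indices of the `s₀` largest coordinates of `h` in absolute
value outside `T₀`. -/
def TopSetOutside {p : ℕ} (h : Fin p → ℝ) (s₀ : ℕ) (T₀ T₁ : Finset (Fin p)) : Prop :=
  T₁.card = s₀ ∧ Disjoint T₀ T₁ ∧
    ∀ i ∈ T₁, ∀ j, j ∉ T₀ → j ∉ T₁ → |h j| ≤ |h i|

/-- `b` is a Lasso minimizer with penalty `lamn` for data `(X, Y)`. -/
def IsLassoSol {n p : ℕ} (X : Matrix (Fin n) (Fin p) ℝ) (Y : Fin n → ℝ)
    (lamn : ℝ) (b : Fin p → ℝ) : Prop :=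
  ∀ b' : Fin p → ℝ,
    1 / (2 * n) * (l2 (Y - X.mulVec b)) ^ 2 + lamn * l1 b ≤
    1 / (2 * n) * (l2 (Y - X.mulVec b')) ^ 2 + lamn * l1 b'

/-- Submatrix of the columns of `X` indexed by `I`. -/
def colSub {n p : ℕ} (X : Matrix (Fin n) (Fin p) ℝ) (I : Finset (Fin p)) :
    Matrix (Fin n) {j // j ∈ I} ℝ :=
  Matrix.of fun i j => X i j.1

/-- The Gram matrix `X_Iᵀ X_I` is invertible. -/
def GramInvertible {n p : ℕ} (X : Matrix (Fin n) (Fin p) ℝ) (I : Finset (Fin p)) : Prop :=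
  IsUnit ((colSub X I)ᵀ * colSub X I).det

/-- The OLS refit of `Y` on the columns of `X` indexed by `I`:
`(X_Iᵀ X_I)⁻¹ X_Iᵀ Y` on `I`, and `0` off `I`. -/
def olsRefit {n p : ℕ} (X : Matrix (Fin n) (Fin p) ℝ) (Y : Fin n → ℝ)
    (I : Finset (Fin p)) : Fin p → ℝ :=
  fun j => if h : j ∈ I then
    (((colSub X I)ᵀ * colSub X I)⁻¹).mulVec ((colSub X I)ᵀ.mulVec Y) ⟨j, h⟩
  else 0


lemma sum_restr_comp {p : ℕ} (v : Fin p → ℝ) (T : Finset (Fin p)) (f : ℝ → ℝ) (hf : f 0 = 0) :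
    ∑ i, f (restr v T i) = ∑ i ∈ T, f (v i) := by
  simp [restr, apply_ite f, hf, Finset.sum_ite_mem]

lemma l1_restr {p : ℕ} (v : Fin p → ℝ) (T : Finset (Fin p)) :
    l1 (restr v T) = ∑ i ∈ T, |v i| :=
  sum_restr_comp v T _ abs_zero

lemma l2_restr {p : ℕ} (v : Fin p → ℝ) (T : Finset (Fin p)) :
    l2 (restr v T) = √(∑ i ∈ T, v i ^ 2) :=
  congrArg Real.sqrt (sum_restr_comp v T (· ^ 2) (by simp))

lemma EssSparsity.mul_pos {p s₀ : ℕ} {β : Fin p → ℝ} {lam σ : ℝ}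
    (hess : EssSparsity β lam σ s₀) (hs₀ : 1 ≤ s₀) (hlam : 0 ≤ lam) (hσ : 0 < σ) :
    0 < lam * σ := by
  rcases hlam.eq_or_lt with rfl | hpos
  · have : s₀ ≤ 0 := hess.2 (by simp [sq_nonneg])
    omega
  · positivity

lemma EssSparsity.le_card_supp {p s₀ : ℕ} {β : Fin p → ℝ} {lam σ : ℝ}
    (hess : EssSparsity β lam σ s₀) : s₀ ≤ (supp β).card := by
  refine hess.2 ?_
  calc ∑ i, min ((β i) ^ 2) (lam ^ 2 * σ ^ 2)
      = ∑ i ∈ supp β, min ((β i) ^ 2) (lam ^ 2 * σ ^ 2) := by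
        refine (Finset.sum_subset (Finset.subset_univ _) fun i _ hi => ?_).symm
        have hi0 : β i = 0 := by simpa [supp] using hi
        rw [hi0, zero_pow two_ne_zero]
        exact min_eq_left (by positivity)
    _ ≤ ∑ _i ∈ supp β, lam ^ 2 * σ ^ 2 := Finset.sum_le_sum fun i _ => min_le_right _ _
    _ = _ := by simp

/-- A top set of size at most `|supp β|` is contained in `supp β`. -/
lemma TopSet.subset_supp {p s₀ : ℕ} {β : Fin p → ℝ} {T₀ : Finset (Fin p)}
    (hT₀ : TopSet β s₀ T₀) (hle : s₀ ≤ (supp β).card) : T₀ ⊆ supp β := by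
  intro i hi
  by_contra hiS
  have hi0 : β i = 0 := by simpa [supp] using hiS
  have hsub : supp β ⊂ T₀ := by
    refine (Finset.ssubset_iff_of_subset fun j hj => ?_).2 ⟨i, hi, hiS⟩
    by_contra hjT
    have := hT₀.2 i hi j hjT
    rw [hi0, abs_zero] at this
    exact (by simpa [supp] using hj : β j ≠ 0) (abs_nonpos_iff.1 this)
  have := Finset.card_lt_card hsub
  have := hT₀.1
  omega

/-- Coordinates outside a top set of essential size are at most `lam * σ`. -/
lemma EssSparsity.sq_le_of_notMem {p s₀ : ℕ} {β : Fin p → ℝ} {lam σ : ℝ}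
    {T₀ : Finset (Fin p)} (hess : EssSparsity β lam σ s₀) (hT₀ : TopSet β s₀ T₀)
    (hpos : 0 < lam * σ) {j : Fin p} (hj : j ∉ T₀) : (β j) ^ 2 ≤ lam ^ 2 * σ ^ 2 := by
  by_contra! hlt
  have hall : ∀ i ∈ insert j T₀, lam ^ 2 * σ ^ 2 ≤ min ((β i) ^ 2) (lam ^ 2 * σ ^ 2) := by
    intro i hi
    refine le_min ?_ le_rfl
    rcases Finset.mem_insert.1 hi with rfl | hi
    · exact hlt.le
    · exact hlt.le.trans (sq_le_sq.2 (hT₀.2 i hi j hj))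
  have hsum := Finset.card_nsmul_le_sum _ _ _ hall
  rw [Finset.card_insert_of_notMem hj, hT₀.1, nsmul_eq_mul] at hsum
  have hmono : ∑ i ∈ insert j T₀, min ((β i) ^ 2) (lam ^ 2 * σ ^ 2) ≤
      ∑ i, min ((β i) ^ 2) (lam ^ 2 * σ ^ 2) :=
    Finset.sum_le_sum_of_subset_of_nonneg (Finset.subset_univ _) fun i _ _ => by positivity
  have hbound : ∑ i, min ((β i) ^ 2) (lam ^ 2 * σ ^ 2) ≤ (s₀ : ℝ) * (lam ^ 2 * σ ^ 2) := hess.1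
  push_cast at hsum
  nlinarith [sq_pos_of_pos hpos]

lemma EssSparsity.sum_sq_compl_le {p s₀ : ℕ} {β : Fin p → ℝ} {lam σ : ℝ}
    {T₀ : Finset (Fin p)} (hess : EssSparsity β lam σ s₀) (hT₀ : TopSet β s₀ T₀)
    (hpos : 0 < lam * σ) : ∑ i ∈ T₀ᶜ, (β i) ^ 2 ≤ s₀ * (lam * σ) ^ 2 := by
  calc ∑ i ∈ T₀ᶜ, (β i) ^ 2
      = ∑ i ∈ T₀ᶜ, min ((β i) ^ 2) (lam ^ 2 * σ ^ 2) := by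
        refine Finset.sum_congr rfl fun i hi => (min_eq_left ?_).symm
        exact hess.sq_le_of_notMem hT₀ hpos (Finset.mem_compl.1 hi)
    _ ≤ ∑ i, min ((β i) ^ 2) (lam ^ 2 * σ ^ 2) :=
        Finset.sum_le_sum_of_subset_of_nonneg (Finset.subset_univ _) fun i _ _ => by positivity
    _ ≤ s₀ * (lam ^ 2 * σ ^ 2) := hess.1
    _ = _ := by ring

/-- Minkowski's inequality for `c + |v i|`, with squares cleared. -/
lemma sum_sq_const_add_abs_le {ι : Type*} (T : Finset ι) (v : ι → ℝ) {c d : ℝ}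
    (hc : 0 ≤ c) (hd : 0 ≤ d) (hv : ∑ i ∈ T, v i ^ 2 ≤ T.card * d ^ 2) :
    ∑ i ∈ T, (c + |v i|) ^ 2 ≤ T.card * (d + c) ^ 2 := by
  have hl1 : ∑ i ∈ T, |v i| ≤ T.card * d := by
    refine le_of_abs_le (abs_le_of_sq_le_sq ?_ (by positivity))
    calc (∑ i ∈ T, |v i|) ^ 2 ≤ T.card * ∑ i ∈ T, |v i| ^ 2 := sq_sum_le_card_mul_sum_sq
      _ ≤ T.card * (T.card * d ^ 2) := by simp only [sq_abs]; gcongr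
      _ = _ := by ring
  have hexp : ∑ i ∈ T, (c + |v i|) ^ 2 =
      T.card * c ^ 2 + 2 * c * ∑ i ∈ T, |v i| + ∑ i ∈ T, v i ^ 2 := by
    simp only [add_sq, sq_abs, Finset.sum_add_distrib, Finset.mul_sum, Finset.sum_const,
      nsmul_eq_mul]
  rw [hexp]
  nlinarith [mul_le_mul_of_nonneg_left hl1 hc]

/-- A deterministic result on thresholding the initial estimator. -/
theorem statement_1
    (n p s s₀ : ℕ) (hn : 0 < n) (hp : 0 < p) (hs₀ : 1 ≤ s₀)
    (β : Fin p → ℝ) (hβ : (supp β).card ≤ s)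
    (σ lam : ℝ) (hσ : 0 < σ) (hlam : lam = Real.sqrt (2 * Real.log p / n))
    (hess : EssSparsity β lam σ s₀)
    (T₀ : Finset (Fin p)) (hT₀ : TopSet β s₀ T₀)
    (βinit h : Fin p → ℝ) (hh : h = βinit - restr β T₀)
    (D₀' D₁ : ℝ) (hD₀' : 0 < D₀') (hD₁ : 0 < D₁)
    (hhead : l2 (restr h T₀) ≤ D₀' * lam * σ * Real.sqrt s₀)
    (htail : l1 (restr h T₀ᶜ) ≤ D₁ * lam * σ * s₀)
    (C₄ t₀ : ℝ) (hC₄ : 0 < C₄) (ht₀ : t₀ = C₄ * lam * σ)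
    (I : Finset (Fin p)) (hI : I = Finset.univ.filter fun j => t₀ ≤ |βinit j|)
    (𝒟 : Finset (Fin p)) (h𝒟 : 𝒟 = Iᶜ) :
    (I.card : ℝ) ≤ s₀ * (1 + D₁ / C₄) ∧
    ((I ∪ supp β).card : ℝ) ≤ s + s₀ * D₁ / C₄ ∧
    l2 (restr β 𝒟) ≤ Real.sqrt ((D₀' + C₄) ^ 2 + 1) * lam * σ * Real.sqrt s₀ := by
  have hpos : 0 < lam * σ := hess.mul_pos hs₀ (hlam ▸ Real.sqrt_nonneg _) hσ
  have ht₀pos : 0 < t₀ := by rw [ht₀, mul_assoc]; positivity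
  have hTS : T₀ ⊆ supp β := hT₀.subset_supp hess.le_card_supp
  have hcardT : (T₀.card : ℝ) = s₀ := by rw [hT₀.1]
  have hout : ((I \ T₀).card : ℝ) ≤ s₀ * D₁ / C₄ := by
    have hge : ∀ i ∈ I \ T₀, t₀ ≤ |h i| := by
      intro i hi
      rw [Finset.mem_sdiff, hI, Finset.mem_filter] at hi
      simpa [hh, restr, hi.2] using hi.1.2
    have hle : ((I \ T₀).card : ℝ) * t₀ ≤ D₁ * lam * σ * s₀ := by
      rw [l1_restr] at htail
      rw [← nsmul_eq_mul]
      refine ((Finset.card_nsmul_le_sum _ _ _ hge).trans ?_).trans htail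
      refine Finset.sum_le_sum_of_subset_of_nonneg (fun i hi => ?_) fun i _ _ => abs_nonneg _
      exact Finset.mem_compl.2 (Finset.mem_sdiff.1 hi).2
    rw [le_div_iff₀ hC₄]
    refine le_of_mul_le_mul_right ?_ hpos
    calc _ = ((I \ T₀).card : ℝ) * t₀ := by rw [ht₀]; ring
      _ ≤ _ := hle
      _ = _ := by ring
  refine ⟨?_, ?_, ?_⟩
  · have hcard : (I.card : ℝ) ≤ T₀.card + (I \ T₀).card := by
      exact_mod_cast (Finset.card_le_card (by simp : I ⊆ T₀ ∪ I \ T₀)).trans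
        (Finset.card_union_le _ _)
    calc (I.card : ℝ) ≤ s₀ + s₀ * D₁ / C₄ := by linarith
      _ = _ := by ring
  · have hsub : I ∪ supp β ⊆ supp β ∪ I \ T₀ := by
      intro i hi
      have := @hTS i
      simp only [Finset.mem_union, Finset.mem_sdiff] at hi ⊢
      tauto
    have hcard : ((I ∪ supp β).card : ℝ) ≤ (supp β).card + (I \ T₀).card := by
      exact_mod_cast (Finset.card_le_card hsub).trans (Finset.card_union_le _ _)
    have hs : ((supp β).card : ℝ) ≤ s := by exact_mod_cast hβ
    linarith
  · have hhead' : ∑ i ∈ T₀, h i ^ 2 ≤ T₀.card * (D₀' * (lam * σ)) ^ 2 := by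
      rw [l2_restr, Real.sqrt_le_iff] at hhead
      refine hhead.2.trans_eq ?_
      rw [mul_pow, Real.sq_sqrt (Nat.cast_nonneg _), hcardT]
      ring
    have hinner : ∑ i ∈ 𝒟 ∩ T₀, β i ^ 2 ≤ s₀ * (D₀' * (lam * σ) + t₀) ^ 2 := by
      rw [← hcardT]
      refine le_trans ?_ (sum_sq_const_add_abs_le T₀ h ht₀pos.le (by positivity) hhead')
      refine (Finset.sum_le_sum fun i hi => ?_).trans
        (Finset.sum_le_sum_of_subset_of_nonneg Finset.inter_subset_right
          fun i _ _ => sq_nonneg _)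
      obtain ⟨hiD, hiT⟩ := Finset.mem_inter.1 hi
      have hsmall : |βinit i| < t₀ := by simpa [h𝒟, hI] using hiD
      have hβi : β i = βinit i - h i := by simp [hh, restr, hiT]
      have habs : |β i| ≤ t₀ + |h i| := by
        rw [hβi]
        exact (abs_sub _ _).trans (by gcongr)
      exact sq_le_sq' (abs_le.1 habs).1 (abs_le.1 habs).2
    have houter : ∑ i ∈ 𝒟 \ T₀, β i ^ 2 ≤ s₀ * (lam * σ) ^ 2 := by
      refine le_trans ?_ (hess.sum_sq_compl_le hT₀ hpos)
      exact Finset.sum_le_sum_of_subset_of_nonneg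
        (fun i hi => Finset.mem_compl.2 (Finset.mem_sdiff.1 hi).2) fun i _ _ => sq_nonneg _
    rw [l2_restr, Real.sqrt_le_iff, mul_assoc (√_) lam σ]
    refine ⟨by positivity, ?_⟩
    rw [mul_pow, mul_pow, Real.sq_sqrt (by positivity), Real.sq_sqrt (Nat.cast_nonneg _),
      ← Finset.sum_inter_add_sum_sdiff 𝒟 T₀]
    refine (add_le_add hinner houter).trans_eq ?_
    rw [ht₀]
    ring

end ThreshLasso
end
end

section
/- Let X be an n×p real matrix with Λ_min(2s) > 0 and Λ_max(2s) < ∞ for some integer s with 2s ≤ p. Let β ∈ ℝ^p with support S and |S| ≤ s, let ε ∈ ℝⁿ, Y = Xβ + ε, σ > 0, a ≥ 0, and λ = √(2·log p/n). Let I ⊆ {1,…,p} be nonempty with |I| ≤ s and |I ∪ S| ≤ 2s, and set 𝒟 = {1,…,p} \ I and S_𝒟 = S ∩ 𝒟. If ‖Xᵀε/n‖_∞ ≤ σ√(1+a)·λ, then X_IᵀX_I is invertible and the OLS refit satisfies ‖β̂^ols(I) − β‖₂² ≤ (2·θ_{|I|,|S_𝒟|}²/Λ_min(|I|)² + 1)·‖β_𝒟‖₂²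 + 2·|I|·(1+a)·σ²λ²/Λ_min(|I|)². -/
open Finset Matrix Real
open scoped BigOperators Classical

noncomputable section

namespace ThreshLasso

theorem l2_sq {m : ℕ} (v : Fin m → ℝ) : l2 v ^ 2 = ∑ i, v i ^ 2 :=
  Real.sq_sqrt (Finset.sum_nonneg fun _ _ => sq_nonneg _)

theorem l2_nonneg {m : ℕ} (v : Fin m → ℝ) : 0 ≤ l2 v := Real.sqrt_nonneg _

theorem l2_pos {m : ℕ} {v : Fin m → ℝ} (hv : v ≠ 0) : 0 < l2 v := by
  obtain ⟨i, hi⟩ := Function.ne_iff.mp hv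
  exact Real.sqrt_pos.mpr <|
    Finset.sum_pos' (fun _ _ => sq_nonneg _) ⟨i, Finset.mem_univ i, sq_pos_iff.mpr hi⟩

/-- A sparse eigenvalue bound in multiplied-out form. -/
theorem IsLambdaMin.mul_sq_le {n p m : ℕ} {X : Matrix (Fin n) (Fin p) ℝ} {L : ℝ}
    (hL : IsLambdaMin X m L) (hn : 0 < n) {v : Fin p → ℝ} (hv : (supp v).card ≤ m) :
    L * (n * l2 v ^ 2) ≤ l2 (X.mulVec v) ^ 2 := by
  by_cases h0 : v = 0
  · simp [h0, l2]
  · have hpos : 0 < (n : ℝ) * l2 v ^ 2 :=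
      mul_pos (Nat.cast_pos.mpr hn) (pow_pos (l2_pos h0) 2)
    exact (le_div_iff₀ hpos).mp (hL.2 ⟨v, h0, hv, rfl⟩)

/-- Minimal sparse eigenvalues are antitone in the sparsity level. -/
theorem IsLambdaMin.antitone {n p m m' : ℕ} {X : Matrix (Fin n) (Fin p) ℝ} {L L' : ℝ}
    (hL : IsLambdaMin X m L) (hL' : IsLambdaMin X m' L') (h : m ≤ m') : L' ≤ L := by
  obtain ⟨v, h0, hv, hr⟩ := hL.1
  exact hL'.2 ⟨v, h0, hv.trans h, hr⟩

theorem supp_subset {p : ℕ} {v : Fin p → ℝ} {T : Finset (Fin p)} (h : ∀ j, j ∉ T → v j = 0) :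
    supp v ⊆ T := by
  intro j hj
  by_contra hT
  exact (Finset.mem_filter.mp hj).2 (h j hT)

/-- If `v` vanishes off `I`, then `X v` only involves the columns indexed by `I`. -/
theorem colSub_mulVec {n p : ℕ} (X : Matrix (Fin n) (Fin p) ℝ) {I : Finset (Fin p)}
    {v : Fin p → ℝ} (hv : ∀ j, j ∉ I → v j = 0) :
    (colSub X I).mulVec (fun j => v j.1) = X.mulVec v := by
  funext i
  simp only [Matrix.mulVec, dotProduct, colSub, Matrix.of_apply]
  rw [Finset.sum_coe_sort I (fun j => X i j * v j)]
  exact Finset.sum_subset (Finset.subset_univ I) fun j _ hj => by rw [hv j hj, mul_zero]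

theorem gramInvertible_of_isLambdaMin {n p : ℕ} {X : Matrix (Fin n) (Fin p) ℝ}
    {I : Finset (Fin p)} {L : ℝ} (hn : 0 < n) (hL : IsLambdaMin X I.card L) (hpos : 0 < L) :
    GramInvertible X I := by
  rw [GramInvertible, isUnit_iff_ne_zero]
  intro hdet
  obtain ⟨w, hw0, hw⟩ := Matrix.exists_mulVec_eq_zero_iff.mpr hdet
  let v : Fin p → ℝ := fun j => if h : j ∈ I then w ⟨j, h⟩ else 0
  have hv : ∀ j, j ∉ I → v j = 0 := fun j hj => dif_neg hj
  have hvw : (fun j : {j // j ∈ I} => v j.1) = w := funext fun j => dif_pos j.2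
  have hXw : (colSub X I).mulVec w = 0 := by
    have h : ((colSub X I).mulVec w) ⬝ᵥ ((colSub X I).mulVec w) = 0 := by
      rw [Matrix.dotProduct_mulVec, ← Matrix.mulVec_transpose, Matrix.mulVec_mulVec, hw,
        zero_dotProduct]
    exact dotProduct_self_eq_zero.mp h
  have hXv : X.mulVec v = 0 := by rw [← colSub_mulVec X hv, hvw, hXw]
  have hv0 : v ≠ 0 := by
    intro h
    exact hw0 (by rw [← hvw, h]; rfl)
  have hle := hL.mul_sq_le hn (Finset.card_le_card (supp_subset hv))
  have hlt : 0 < L * (n * l2 v ^ 2) :=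
    mul_pos hpos (mul_pos (Nat.cast_pos.mpr hn) (pow_pos (l2_pos hv0) 2))
  rw [hXv, l2_sq 0] at hle
  simp only [Pi.zero_apply, zero_pow two_ne_zero, Finset.sum_const_zero] at hle
  exact hle.not_gt hlt

theorem olsRefit_of_notMem {n p : ℕ} (X : Matrix (Fin n) (Fin p) ℝ) (Y : Fin n → ℝ)
    {I : Finset (Fin p)} {j : Fin p} (hj : j ∉ I) : olsRefit X Y I j = 0 :=
  dif_neg hj

/-- Normal equations: the fitted values of the refit and `Y` have the same inner product
with every vector in the span of the columns indexed by `I`. -/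
theorem mulVec_dotProduct_mulVec_olsRefit {n p : ℕ} {X : Matrix (Fin n) (Fin p) ℝ}
    {Y : Fin n → ℝ} {I : Finset (Fin p)} (hG : GramInvertible X I)
    {v : Fin p → ℝ} (hv : ∀ j, j ∉ I → v j = 0) :
    X.mulVec v ⬝ᵥ X.mulVec (olsRefit X Y I) = X.mulVec v ⬝ᵥ Y := by
  have hb : (fun j : {j // j ∈ I} => olsRefit X Y I j.1) =
      (((colSub X I)ᵀ * colSub X I)⁻¹).mulVec ((colSub X I)ᵀ.mulVec Y) :=
    funext fun j => dif_pos j.2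
  have key : (colSub X I)ᵀ.mulVec (X.mulVec (olsRefit X Y I)) = (colSub X I)ᵀ.mulVec Y := by
    rw [← colSub_mulVec X (fun j hj => olsRefit_of_notMem X Y hj), hb, Matrix.mulVec_mulVec,
      Matrix.mulVec_mulVec, Matrix.mul_nonsing_inv _ hG, Matrix.one_mulVec]
  rw [← colSub_mulVec X hv, dotProduct_comm, Matrix.dotProduct_mulVec, ← Matrix.mulVec_transpose,
    key, Matrix.mulVec_transpose, ← Matrix.dotProduct_mulVec, dotProduct_comm]

/-- Restricted orthogonality bounds the empirical inner product of two vectors. -/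
theorem IsTheta.dotProduct_le {n p m m' : ℕ} {X : Matrix (Fin n) (Fin p) ℝ} {θ : ℝ}
    (hθ : IsTheta X m m' θ) (hn : 0 < n) {u u' : Fin p → ℝ} {T T' : Finset (Fin p)}
    (hTT' : Disjoint T T') (hT : T.card ≤ m) (hT' : T'.card ≤ m')
    (hu : ∀ j, j ∉ T → u j = 0) (hu' : ∀ j, j ∉ T' → u' j = 0) :
    X.mulVec u ⬝ᵥ X.mulVec u' ≤ n * (θ * (l2 u * l2 u')) := by
  have h := hθ.1.2 u u' T T' hTT' hT hT' hu hu'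
  rw [div_le_iff₀ (Nat.cast_pos.mpr hn), mul_comm] at h
  exact (le_abs_self _).trans h

/-- The correlation of `X v` with a noise vector, for `v` supported on `I`. -/
theorem mulVec_dotProduct_noise_le {n p : ℕ} {X : Matrix (Fin n) (Fin p) ℝ} {ε : Fin n → ℝ}
    {τ : ℝ} (hn : 0 < n) (hnoise : ∀ j, |(∑ i, X i j * ε i) / n| ≤ τ)
    {I : Finset (Fin p)} {v : Fin p → ℝ} (hv : ∀ j, j ∉ I → v j = 0) (hτ : 0 ≤ τ) :
    X.mulVec v ⬝ᵥ ε ≤ n * (l2 v * (√I.card * τ)) := by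
  have hn' : (0 : ℝ) < n := Nat.cast_pos.mpr hn
  have hsum : X.mulVec v ⬝ᵥ ε = ∑ j ∈ I, v j * ∑ i, X i j * ε i := by
    rw [dotProduct_comm, Matrix.dotProduct_mulVec, dotProduct_comm]
    simp only [Matrix.vecMul, dotProduct]
    rw [← Finset.sum_subset (Finset.subset_univ I) fun j _ hj => by rw [hv j hj, zero_mul]]
    simp only [mul_comm (ε _)]
  have hl2 : l2 v = √(∑ j ∈ I, |v j| ^ 2) := by
    rw [l2, ← Finset.sum_subset (Finset.subset_univ I) fun j _ hj => by
      rw [hv j hj, zero_pow two_ne_zero]]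
    simp only [sq_abs]
  have hcs : ∑ j ∈ I, |v j| ≤ l2 v * √I.card := by
    simpa [hl2] using Real.sum_mul_le_sqrt_mul_sqrt I (fun j => |v j|) (fun _ => 1)
  calc X.mulVec v ⬝ᵥ ε ≤ ∑ j ∈ I, |v j| * (n * τ) := by
        rw [hsum]
        refine Finset.sum_le_sum fun j _ => (le_abs_self _).trans ?_
        rw [abs_mul]
        refine mul_le_mul_of_nonneg_left ?_ (abs_nonneg _)
        have h := hnoise j
        rwa [abs_div, Nat.abs_cast, div_le_iff₀ hn', mul_comm] at h
    _ = (∑ j ∈ I, |v j|) * (n * τ) := (Finset.sum_mul ..).symm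
    _ ≤ (l2 v * √I.card) * (n * τ) := by gcongr
    _ = n * (l2 v * (√I.card * τ)) := by ring

theorem sq_le_two_mul_of_mul_sq_le {L x b c : ℝ} (hL : 0 < L) (hx : 0 ≤ x) (hb : 0 ≤ b)
    (hc : 0 ≤ c) (h : L * x ^ 2 ≤ x * b + x * c) :
    x ^ 2 ≤ 2 * b ^ 2 / L ^ 2 + 2 * c ^ 2 / L ^ 2 := by
  have hLx : L * x ≤ b + c := by
    rcases hx.eq_or_lt with rfl | hx
    · simpa using add_nonneg hb hc
    · exact le_of_mul_le_mul_left (by linarith) hx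
  rw [← add_div, le_div_iff₀ (by positivity)]
  nlinarith [pow_le_pow_left₀ (mul_nonneg hL.le hx) hLx 2, sq_nonneg (b - c)]

/-- Pythagoras for the error of an estimator supported on `I`. -/
theorem l2_sub_sq {p : ℕ} {b β : Fin p → ℝ} {I : Finset (Fin p)} (hb : ∀ j, j ∉ I → b j = 0) :
    l2 (b - β) ^ 2 = l2 (b - restr β I) ^ 2 + l2 (restr β Iᶜ) ^ 2 := by
  simp only [l2_sq, ← Finset.sum_add_distrib]
  refine Finset.sum_congr rfl fun j _ => ?_
  by_cases hj : j ∈ I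
  · simp [restr, hj]
  · simp [restr, hj, hb j hj]

theorem restr_add_restr_compl {p : ℕ} (β : Fin p → ℝ) (I : Finset (Fin p)) :
    restr β I + restr β Iᶜ = β := by
  funext j
  by_cases hj : j ∈ I <;> simp [restr, hj]

/-- OLS estimator with missing variables (random selection set). -/
theorem statement_2
    (n p s : ℕ) (hn : 0 < n) (hs : 1 ≤ s) (h2s : 2 * s ≤ p)
    (X : Matrix (Fin n) (Fin p) ℝ)
    (Lmin2s Lmax2s : ℝ)
    (hLmin2s : IsLambdaMin X (2 * s) Lmin2s) (hLmin2spos : 0 < Lmin2s)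
    (hLmax2s : IsLambdaMax X (2 * s) Lmax2s)
    (β : Fin p → ℝ) (hβ : (supp β).card ≤ s)
    (ε Y : Fin n → ℝ) (hY : Y = X.mulVec β + ε)
    (σ a lam : ℝ) (hσ : 0 < σ) (ha : 0 ≤ a)
    (hlam : lam = Real.sqrt (2 * Real.log p / n))
    (I : Finset (Fin p)) (hne : I.Nonempty) (hIcard : I.card ≤ s)
    (hIS : (I ∪ supp β).card ≤ 2 * s)
    (𝒟 : Finset (Fin p)) (h𝒟 : 𝒟 = Iᶜ)
    (S𝒟 : Finset (Fin p)) (hS𝒟 : S𝒟 = supp β ∩ 𝒟)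
    (hnoise : ∀ j, |(∑ i, X i j * ε i) / n| ≤ σ * Real.sqrt (1 + a) * lam)
    (θ LminI : ℝ) (hθ : IsTheta X I.card S𝒟.card θ)
    (hLminI : IsLambdaMin X I.card LminI) :
    GramInvertible X I ∧
    (l2 (olsRefit X Y I - β)) ^ 2 ≤
      (2 * θ ^ 2 / LminI ^ 2 + 1) * (l2 (restr β 𝒟)) ^ 2 +
        2 * I.card * (1 + a) * σ ^ 2 * lam ^ 2 / LminI ^ 2 := by
  have hLpos : 0 < LminI :=
    hLmin2spos.trans_le (hLminI.antitone hLmin2s (by omega))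
  have hG := gramInvertible_of_isLambdaMin hn hLminI hLpos
  refine ⟨hG, ?_⟩
  subst hY h𝒟 hS𝒟
  set b := olsRefit X (X.mulVec β + ε) I
  have hb : ∀ j, j ∉ I → b j = 0 := fun j hj => olsRefit_of_notMem X _ hj
  set h := b - restr β I with hh
  have hhI : ∀ j, j ∉ I → h j = 0 := fun j hj => by simp [hh, restr, hj, hb j hj]
  have hDS : ∀ j, j ∉ supp β ∩ Iᶜ → restr β Iᶜ j = 0 := fun j hj => by
    by_contra h0
    simp only [restr, Finset.mem_compl, ite_eq_right_iff, not_forall] at h0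
    exact hj (by simpa [supp, h0.1] using h0.2)
  have hdisj : Disjoint I (supp β ∩ Iᶜ) :=
    (disjoint_compl_right (a := I)).mono_right Finset.inter_subset_right
  have hlam0 : 0 ≤ lam := hlam ▸ Real.sqrt_nonneg _
  have hτ : 0 ≤ σ * √(1 + a) * lam := by positivity
  have hn' : (0 : ℝ) < n := Nat.cast_pos.mpr hn
  have hbasic : l2 (X.mulVec h) ^ 2 =
      X.mulVec h ⬝ᵥ X.mulVec (restr β Iᶜ) + X.mulVec h ⬝ᵥ ε := by
    have hnormal : X.mulVec h ⬝ᵥ X.mulVec b = X.mulVec h ⬝ᵥ (X.mulVec β + ε) :=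
      mulVec_dotProduct_mulVec_olsRefit hG hhI
    have hself : l2 (X.mulVec h) ^ 2 = X.mulVec h ⬝ᵥ X.mulVec h := by
      rw [l2_sq]
      simp only [dotProduct, sq]
    have hsplit : X.mulVec β = X.mulVec (restr β I) + X.mulVec (restr β Iᶜ) := by
      rw [← Matrix.mulVec_add, restr_add_restr_compl]
    have hsub : X.mulVec h = X.mulVec b - X.mulVec (restr β I) := Matrix.mulVec_sub ..
    rw [hsplit] at hnormal
    rw [hself]
    nth_rewrite 2 [hsub]
    rw [dotProduct_sub, hnormal]
    simp only [dotProduct_add]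
    ring
  have hmain : LminI * l2 h ^ 2 ≤
      l2 h * (θ * l2 (restr β Iᶜ)) + l2 h * (√I.card * (σ * √(1 + a) * lam)) := by
    refine le_of_mul_le_mul_left ?_ hn'
    have h1 := hLminI.mul_sq_le hn (Finset.card_le_card (supp_subset hhI))
    have h2 := hθ.dotProduct_le hn hdisj le_rfl le_rfl hhI hDS
    have h3 := mulVec_dotProduct_noise_le hn hnoise hhI hτ
    linarith
  have hfin := sq_le_two_mul_of_mul_sq_le hLpos (l2_nonneg h)
    (mul_nonneg hθ.1.1 (l2_nonneg _)) (mul_nonneg (Real.sqrt_nonneg _) hτ) hmain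
  have hcard : (√I.card * (σ * √(1 + a) * lam)) ^ 2 = I.card * (1 + a) * σ ^ 2 * lam ^ 2 := by
    rw [mul_pow, mul_pow, mul_pow, Real.sq_sqrt (Nat.cast_nonneg _), Real.sq_sqrt (by linarith)]
    ring
  rw [hcard] at hfin
  rw [l2_sub_sq hb]
  refine (add_le_add_left hfin _).trans_eq ?_
  ring

end ThreshLasso
end
end
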